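/- Let F be a Minkowski norm on ℝⁿ with positive definite fundamental tensor, and let W ⊂ ℝⁿ be a hyperplane (codimension-1 subspace). Then there exist exactly two vectors v ∈ ℝⁿ with F(v) = 1 and g_v(v,u) = 0 for all u ∈ W, and they lie on opposite sides of W. -/

import Mathlib

/-- The fundamental tensor of `F`: half the Hessian of `F²` at `v`, evaluated on `(u, w)`. -/
noncomputable def fundTensor {m : ℕ} (F : (Fin m → ℝ) → ℝ) (v u w : Fin m → ℝ) : ℝ :=
  (1 / 2) * deriv (fun δ : ℝ => deriv (fun η : ℝ => (F (v + δ • u + η • w)) ^ 2) 0) 0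

section MinkowskiNorm

variable {m : ℕ} {F : (Fin m → ℝ) → ℝ}

theorem fundTensor_eq_deriv_fderiv
    (hd : ∀ x : Fin m → ℝ, x ≠ 0 → DifferentiableAt ℝ F x) {v : Fin m → ℝ} (hv : v ≠ 0)
    (u w : Fin m → ℝ) :
    fundTensor F v u w =
      (1 / 2) * deriv (fun δ : ℝ => fderiv ℝ (fun x => F x ^ 2) (v + δ • u) w) 0 := by
  unfold fundTensor
  congr 1
  apply Filter.EventuallyEq.deriv_eq
  have hc : ContinuousAt (fun δ : ℝ => v + δ • u) 0 := by fun_prop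
  filter_upwards [hc.eventually_ne (y := 0) (by simpa using hv)] with δ hδ
  have hG : HasFDerivAt (fun x => F x ^ 2) (fderiv ℝ (fun x => F x ^ 2) (v + δ • u))
      (v + δ • u) := ((hd _ hδ).pow 2).hasFDerivAt
  exact (hG.hasLineDerivAt w).deriv

theorem fderiv_smul_of_posHom (hhom : ∀ v : Fin m → ℝ, ∀ c : ℝ, 0 < c → F (c • v) = c * F v)
    {c : ℝ} (hc : 0 < c) (v : Fin m → ℝ) : fderiv ℝ F (c • v) = fderiv ℝ F v := by
  have h1 : fderiv ℝ (fun x => F (c • x)) v = c • fderiv ℝ F (c • v) :=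
    fderiv_comp_smul c
  have h2 : (fun x => F (c • x)) = c • F := by
    ext x
    simpa using hhom x c hc
  rw [h2, fderiv_const_smul_field] at h1
  exact (smul_right_injective _ hc.ne' h1).symm

/-- The Euler identity for positively homogeneous functions of degree one. -/
theorem fderiv_self_of_posHom (hhom : ∀ v : Fin m → ℝ, ∀ c : ℝ, 0 < c → F (c • v) = c * F v)
    {v : Fin m → ℝ} (hv : DifferentiableAt ℝ F v) : fderiv ℝ F v v = F v := by
  have h1 : HasDerivAt (fun t : ℝ => F (v + t • v)) (fderiv ℝ F v v) 0 :=
    hv.hasFDerivAt.hasLineDerivAt v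
  have h2 : HasDerivAt (fun t : ℝ => (1 + t) * F v) (F v) 0 := by
    simpa using ((hasDerivAt_id (0 : ℝ)).const_add 1).mul_const (F v)
  refine h1.unique (h2.congr_of_eventuallyEq ?_)
  filter_upwards [lt_mem_nhds (show (-1 : ℝ) < 0 by norm_num)] with t ht
  rw [← hhom v (1 + t) (by linarith), add_smul, one_smul]

theorem fderiv_sq_apply {v : Fin m → ℝ} (hv : DifferentiableAt ℝ F v) (u : Fin m → ℝ) :
    fderiv ℝ (fun x => F x ^ 2) v u = 2 * F v * fderiv ℝ F v u := by
  simp [fderiv_fun_pow 2 hv]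

theorem fundTensor_self_left (hhom : ∀ v : Fin m → ℝ, ∀ c : ℝ, 0 < c → F (c • v) = c * F v)
    (hd : ∀ x : Fin m → ℝ, x ≠ 0 → DifferentiableAt ℝ F x) {v : Fin m → ℝ} (hv : v ≠ 0)
    (u : Fin m → ℝ) : fundTensor F v v u = F v * fderiv ℝ F v u := by
  rw [fundTensor_eq_deriv_fderiv hd hv]
  have h : HasDerivAt (fun t : ℝ => (1 + t) * (2 * F v * fderiv ℝ F v u))
      (2 * F v * fderiv ℝ F v u) 0 := by
    simpa using ((hasDerivAt_id (0 : ℝ)).const_add 1).mul_const (2 * F v * fderiv ℝ F v u)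
  rw [(h.congr_of_eventuallyEq ?_).deriv]
  · ring
  filter_upwards [lt_mem_nhds (show (-1 : ℝ) < 0 by norm_num)] with t ht
  have ht' : 0 < 1 + t := by linarith
  have e : v + t • v = (1 + t) • v := by rw [add_smul, one_smul]
  rw [e, fderiv_sq_apply (hd _ (smul_ne_zero ht'.ne' hv)), fderiv_smul_of_posHom hhom ht',
    hhom v _ ht']
  ring

/-- The maximum of `ω / F` is attained at a point where `F` is stationary along `ker ω`. -/
theorem exists_unit_fderiv_eq_zero_of_dual (hpos : ∀ v : Fin m → ℝ, v ≠ 0 → 0 < F v)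
    (hhom : ∀ v : Fin m → ℝ, ∀ c : ℝ, 0 < c → F (c • v) = c * F v)
    (hd : ∀ x : Fin m → ℝ, x ≠ 0 → DifferentiableAt ℝ F x)
    {ω : Module.Dual ℝ (Fin m → ℝ)} (hω : ω ≠ 0) :
    ∃ v, v ≠ 0 ∧ F v = 1 ∧ 0 < ω v ∧ ∀ u, ω u = 0 → fderiv ℝ F v u = 0 := by
  have hωc : Continuous ω := ω.continuous_of_finiteDimensional
  obtain ⟨a, ha⟩ : ∃ a, 0 < ω a := by
    obtain ⟨a, ha⟩ : ∃ a, ω a ≠ 0 := by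
      by_contra! h
      exact hω (LinearMap.ext h)
    rcases ha.lt_or_gt with h | h
    · exact ⟨-a, by simpa using h⟩
    · exact ⟨a, h⟩
  have ha0 : a ≠ 0 := by
    rintro rfl
    simp at ha
  have hsphere : ∀ x ∈ Metric.sphere (0 : Fin m → ℝ) 1, x ≠ 0 := fun x hx =>
    ne_zero_of_mem_unit_sphere ⟨x, hx⟩
  have hnormalize : ∀ x : Fin m → ℝ, x ≠ 0 → ‖x‖⁻¹ • x ∈ Metric.sphere (0 : Fin m → ℝ) 1 := by
    intro x hx
    simp [norm_smul, hx]
  have hquot : ∀ x : Fin m → ℝ, x ≠ 0 → ∀ c : ℝ, 0 < c → ω (c • x) / F (c • x) = ω x / F x := by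
    intro x hx c hc
    rw [hhom x c hc, map_smul, smul_eq_mul, mul_div_mul_left _ _ hc.ne']
  obtain ⟨p, hp, hmax⟩ := (isCompact_sphere (0 : Fin m → ℝ) 1).exists_isMaxOn
    ⟨_, hnormalize a ha0⟩ (f := fun x => ω x / F x) (fun x hx =>
      (hωc.continuousAt.div (hd x (hsphere x hx)).continuousAt
        (hpos x (hsphere x hx)).ne').continuousWithinAt)
  have hp0 := hsphere p hp
  have hFp := hpos p hp0
  have hle : ∀ x : Fin m → ℝ, x ≠ 0 → ω x / F x ≤ ω p / F p := by
    intro x hx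
    rw [← hquot x hx ‖x‖⁻¹ (by positivity)]
    exact hmax (hnormalize x hx)
  have hM : 0 < ω p / F p := (div_pos ha (hpos a ha0)).trans_le (hle a ha0)
  have hωp : 0 < ω p := (div_pos_iff_of_pos_right hFp).1 hM
  have hmin : IsLocalMin (fun x => ω p / F p * F x - LinearMap.toContinuousLinearMap ω x) p := by
    filter_upwards [isOpen_ne.mem_nhds hp0] with x hx
    have h1 := (div_le_iff₀ (hpos x hx)).1 (hle x hx)
    have h2 : ω p / F p * F p = ω p := div_mul_cancel₀ _ hFp.ne'
    simp only [LinearMap.coe_toContinuousLinearMap']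
    linarith
  have hder := hmin.hasFDerivAt_eq_zero
    (((hd p hp0).hasFDerivAt.const_mul _).sub
      (LinearMap.toContinuousLinearMap ω).hasFDerivAt)
  refine ⟨(F p)⁻¹ • p, smul_ne_zero (by positivity) hp0, ?_, ?_, fun u hu => ?_⟩
  · rw [hhom _ _ (by positivity), inv_mul_cancel₀ hFp.ne']
  · rw [map_smul, smul_eq_mul]
    positivity
  · rw [fderiv_smul_of_posHom hhom (by positivity)]
    have h := DFunLike.congr_fun hder u
    simpa [hu, hωp.ne', hFp.ne'] using h

theorem eq_of_fderiv_eq_zero_of_dual_eq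
    (hd : ∀ x : Fin m → ℝ, x ≠ 0 → DifferentiableAt ℝ F x)
    (hposdef : ∀ v : Fin m → ℝ, v ≠ 0 → ∀ u : Fin m → ℝ, u ≠ 0 → 0 < fundTensor F v u u)
    {ω : Module.Dual ℝ (Fin m → ℝ)} {p q : Fin m → ℝ} (hp0 : ω p ≠ 0) (hpq : ω p = ω q)
    (hp : ∀ u, ω u = 0 → fderiv ℝ F p u = 0) (hq : ∀ u, ω u = 0 → fderiv ℝ F q u = 0) :
    p = q := by
  by_contra hne
  have hu : p - q ≠ 0 := sub_ne_zero.2 hne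
  have hωu : ω (p - q) = 0 := by rw [map_sub, hpq, sub_self]
  have hne0 : ∀ t : ℝ, q + t • (p - q) ≠ 0 := by
    intro t h
    apply hp0
    have := congrArg ω h
    rw [map_add, map_smul, hωu, smul_zero, add_zero, map_zero] at this
    rw [hpq, this]
  have hmono : StrictMono
      (fun t : ℝ => fderiv ℝ (fun x => F x ^ 2) (q + t • (p - q)) (p - q)) := by
    refine strictMono_of_deriv_pos fun t => ?_
    have h := hposdef _ (hne0 t) _ hu
    rw [fundTensor_eq_deriv_fderiv hd (hne0 t)] at h
    have h2 := deriv_comp_const_add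
      (fun t : ℝ => fderiv ℝ (fun x => F x ^ 2) (q + t • (p - q)) (p - q)) t 0
    simp only [add_smul, ← add_assoc, add_zero] at h2
    rw [h2] at h
    linarith
  have h := hmono zero_lt_one
  have hq0 : q ≠ 0 := by simpa using hne0 0
  have hp0 : p ≠ 0 := by simpa using hne0 1
  simp [fderiv_sq_apply (hd _ hq0), fderiv_sq_apply (hd _ hp0), -map_sub, hp _ hωu,
    hq _ hωu] at h

theorem unit_eq_of_fderiv_eq_zero_of_dual_pos
    (hhom : ∀ v : Fin m → ℝ, ∀ c : ℝ, 0 < c → F (c • v) = c * F v)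
    (hd : ∀ x : Fin m → ℝ, x ≠ 0 → DifferentiableAt ℝ F x)
    (hposdef : ∀ v : Fin m → ℝ, v ≠ 0 → ∀ u : Fin m → ℝ, u ≠ 0 → 0 < fundTensor F v u u)
    {ω : Module.Dual ℝ (Fin m → ℝ)} {p q : Fin m → ℝ} (hFp : F p = 1) (hFq : F q = 1)
    (hωp : 0 < ω p) (hωq : 0 < ω q)
    (hp : ∀ u, ω u = 0 → fderiv ℝ F p u = 0) (hq : ∀ u, ω u = 0 → fderiv ℝ F q u = 0) :
    p = q := by
  have hc : 0 < ω q / ω p := div_pos hωq hωp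
  have hs : ω ((ω q / ω p) • p) = ω q := by
    rw [map_smul, smul_eq_mul, div_mul_cancel₀ _ hωp.ne']
  have h : (ω q / ω p) • p = q :=
    eq_of_fderiv_eq_zero_of_dual_eq hd hposdef (hs.trans_ne hωq.ne') hs
      (by rwa [fderiv_smul_of_posHom hhom hc]) hq
  have h1 : ω q / ω p = 1 := by
    have := hhom p _ hc
    rw [h, hFp, hFq] at this
    linarith
  rwa [h1, one_smul] at h

end MinkowskiNorm

theorem Submodule.exists_dual_ker_eq_of_finrank_eq {m : ℕ} (hm : 1 ≤ m)
    {W : Submodule ℝ (Fin m → ℝ)} (hW : Module.finrank ℝ W = m - 1) :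
    ∃ ω : Module.Dual ℝ (Fin m → ℝ), ω ≠ 0 ∧ LinearMap.ker ω = W := by
  have hlt : W < ⊤ := by
    refine lt_top_iff_ne_top.2 fun h => ?_
    rw [h, finrank_top, Module.finrank_fin_fun] at hW
    omega
  obtain ⟨ω, hω, hle⟩ := W.exists_le_ker_of_lt_top hlt
  refine ⟨ω, hω, (Submodule.eq_of_le_of_finrank_eq hle ?_).symm⟩
  have := Module.Dual.finrank_ker_add_one_of_ne_zero hω
  rw [Module.finrank_fin_fun] at this
  omega

/-- For a Minkowski norm `F` and a hyperplane `W`, there are exactly two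
`F`-unit vectors `F`-orthogonal to `W`, and they lie on opposite sides of `W`. -/
theorem stmt15 {m : ℕ} (hm : 1 ≤ m) (F : (Fin m → ℝ) → ℝ)
    (hpos : ∀ v : Fin m → ℝ, v ≠ 0 → 0 < F v)
    (hhom : ∀ v : Fin m → ℝ, ∀ lam : ℝ, 0 < lam → F (lam • v) = lam * F v)
    (hsmooth : ContDiffOn ℝ (⊤ : ℕ∞) F {(0 : Fin m → ℝ)}ᶜ)
    (hposdef : ∀ v : Fin m → ℝ, v ≠ 0 → ∀ u : Fin m → ℝ, u ≠ 0 →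
      0 < fundTensor F v u u)
    (W : Submodule ℝ (Fin m → ℝ)) (hW : Module.finrank ℝ W = m - 1) :
    ∃ v₁ v₂ : Fin m → ℝ, v₁ ≠ v₂ ∧
      (F v₁ = 1 ∧ ∀ u ∈ W, fundTensor F v₁ v₁ u = 0) ∧
      (F v₂ = 1 ∧ ∀ u ∈ W, fundTensor F v₂ v₂ u = 0) ∧
      (∀ v : Fin m → ℝ, F v = 1 → (∀ u ∈ W, fundTensor F v v u = 0) →
        v = v₁ ∨ v = v₂) ∧
      ∀ ω : Module.Dual ℝ (Fin m → ℝ), ω ≠ 0 → (∀ u ∈ W, ω u = 0) →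
        ω v₁ * ω v₂ < 0 := by
  have hd : ∀ x : Fin m → ℝ, x ≠ 0 → DifferentiableAt ℝ F x := fun x hx =>
    (hsmooth.contDiffAt (isOpen_compl_singleton.mem_nhds hx)).differentiableAt (by simp)
  obtain ⟨ω, hω, hker⟩ := Submodule.exists_dual_ker_eq_of_finrank_eq hm hW
  have hmem : ∀ u, u ∈ W ↔ ω u = 0 := fun u => by rw [← hker, LinearMap.mem_ker]
  obtain ⟨v₁, hne₁, hF₁, hω₁, hD₁⟩ := exists_unit_fderiv_eq_zero_of_dual hpos hhom hd hω
  obtain ⟨v₂, hne₂, hF₂, hω₂, hD₂⟩ :=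
    exists_unit_fderiv_eq_zero_of_dual hpos hhom hd (neg_ne_zero.2 hω)
  have hω₂' : ω v₂ < 0 := by simpa using hω₂
  refine ⟨v₁, v₂, ?_, ⟨hF₁, fun u hu => ?_⟩, ⟨hF₂, fun u hu => ?_⟩, fun v hFv hv => ?_,
    fun ω' hω' hvan => ?_⟩
  · rintro rfl
    exact lt_asymm hω₁ hω₂'
  · rw [fundTensor_self_left hhom hd hne₁, hD₁ u ((hmem u).1 hu), mul_zero]
  · rw [fundTensor_self_left hhom hd hne₂, hD₂ u (by simpa using (hmem u).1 hu), mul_zero]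
  · have hv0 : v ≠ 0 := by
      rintro rfl
      have := hhom 0 2 two_pos
      rw [smul_zero, hFv] at this
      norm_num at this
    have hD : ∀ u, ω u = 0 → fderiv ℝ F v u = 0 := by
      intro u hu
      have := hv u ((hmem u).2 hu)
      rwa [fundTensor_self_left hhom hd hv0, hFv, one_mul] at this
    have hωv : ω v ≠ 0 := by
      intro h
      have := fderiv_self_of_posHom hhom (hd v hv0)
      rw [hD v h, hFv] at this
      norm_num at this
    rcases hωv.lt_or_gt with h | h
    · exact .inr <| unit_eq_of_fderiv_eq_zero_of_dual_pos hhom hd hposdef (ω := -ω) hFv hF₂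
        (by simpa using h) hω₂ (fun u hu => hD u (by simpa using hu)) hD₂
    · exact .inl <| unit_eq_of_fderiv_eq_zero_of_dual_pos hhom hd hposdef hFv hF₁ h hω₁ hD hD₁
  · have key : ∀ x, ω' x = ω x / ω v₁ * ω' v₁ := by
      intro x
      have := hvan (x - (ω x / ω v₁) • v₁) ((hmem _).2 (by simp [hω₁.ne']))
      rw [map_sub, map_smul, smul_eq_mul] at this
      linarith
    have hne : ω' v₁ ≠ 0 := fun h => hω' (LinearMap.ext fun x => by simp [key x, h])
    have hneg : ω v₂ / ω v₁ < 0 := div_neg_of_neg_of_pos hω₂' hω₁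
    rw [key v₂]
    nlinarith [mul_neg_of_neg_of_pos hneg (mul_self_pos.2 hne)]
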